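/- Let θ, θ' ∈ B₁ and set ε := D(θ, θ'). Then: (a) ‖θ − θ'‖₁ ≤ 2ε; and (b) if ε > 0, there exists θ'' ∈ B₁ such that θ = (1 − ε)θ' + ε θ''. -/

import Mathlib

open Finset

/-- ℓ¹-norm on `Fin d → ℝ`. -/
noncomputable def l1 {d : ℕ} (x : Fin d → ℝ) : ℝ := ∑ i, |x i|

/-- Averaging accelerability `D(θ, θ')`. -/
noncomputable def Dacc {d : ℕ} (θ θ' : Fin d → ℝ) : ℝ :=
  sInf {p : ℝ | p ∈ Set.Icc (0 : ℝ) 1 ∧ l1 (θ - (1 - p) • θ') ≤ p}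

theorem l1_add_le {d : ℕ} (x y : Fin d → ℝ) : l1 (x + y) ≤ l1 x + l1 y := by
  simp only [l1, ← Finset.sum_add_distrib, Pi.add_apply]
  exact Finset.sum_le_sum fun i _ => abs_add_le _ _

theorem l1_smul {d : ℕ} (c : ℝ) (x : Fin d → ℝ) : l1 (c • x) = |c| * l1 x := by
  simp [l1, Finset.mul_sum, abs_mul]

theorem continuous_l1 {d : ℕ} : Continuous (l1 : (Fin d → ℝ) → ℝ) := by
  unfold l1
  fun_prop

/-- The infimum defining the averaging accelerability is attained. -/
theorem Dacc_mem {d : ℕ} (θ θ' : Fin d → ℝ) (hθ : l1 θ ≤ 1) :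
    Dacc θ θ' ∈ Set.Icc (0 : ℝ) 1 ∧ l1 (θ - (1 - Dacc θ θ') • θ') ≤ Dacc θ θ' := by
  have hclosed : IsClosed
      {p : ℝ | p ∈ Set.Icc (0 : ℝ) 1 ∧ l1 (θ - (1 - p) • θ') ≤ p} :=
    isClosed_Icc.inter
      (isClosed_le (continuous_l1.comp (by fun_prop)) continuous_id)
  exact hclosed.csInf_mem ⟨1, by simp, by simpa using hθ⟩ ⟨0, fun p hp => hp.1.1⟩

/-- Decomposition and ℓ¹-proximity facts about the averaging accelerability used in
the proof of Theorem 2 of the paper: with `ε = D(θ,θ')`, (a) `‖θ - θ'‖₁ ≤ 2ε`, and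
(b) if `ε > 0` then `θ = (1-ε)θ' + εθ''` for some `θ'' ∈ B₁`. -/
theorem Dacc_decomposition {d : ℕ} (θ θ' : Fin d → ℝ)
    (hθ : l1 θ ≤ 1) (hθ' : l1 θ' ≤ 1) :
    l1 (θ - θ') ≤ 2 * Dacc θ θ' ∧
    (0 < Dacc θ θ' → ∃ θ'' : Fin d → ℝ, l1 θ'' ≤ 1 ∧
      θ = (1 - Dacc θ θ') • θ' + Dacc θ θ' • θ'') := by
  obtain ⟨⟨h0, -⟩, hle⟩ := Dacc_mem θ θ' hθ
  set ε := Dacc θ θ'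
  refine ⟨?_, fun hpos => ⟨ε⁻¹ • (θ - (1 - ε) • θ'), ?_, ?_⟩⟩
  · have hsub : θ - θ' = (θ - (1 - ε) • θ') + (-ε) • θ' := by module
    calc l1 (θ - θ') ≤ l1 (θ - (1 - ε) • θ') + l1 ((-ε) • θ') := by
          rw [hsub]
          exact l1_add_le _ _
      _ = l1 (θ - (1 - ε) • θ') + ε * l1 θ' := by rw [l1_smul, abs_neg, abs_of_nonneg h0]
      _ ≤ 2 * ε := by linarith [mul_le_of_le_one_right h0 hθ']
  · rw [l1_smul, abs_of_pos (inv_pos.mpr hpos)]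
    exact inv_mul_le_one_of_le₀ hle h0
  · rw [smul_inv_smul₀ hpos.ne']
    module
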